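/- Let G_A and G_B be graphs that are universally rigid in ℝ^d, whose shared vertex set V_C = V_A ∩ V_B satisfies |V_C| ≥ d + 1 and is a proper subset of both V_A and V_B. Let p_A and p_B be configurations of G_A and G_B in ℝ^d, each in general position, agreeing on V_C, and suppose the frameworks G_A(p_A) and G_B(p_B) each have a positive semidefinite stress matrix of nullity d + 1. Then the edge-reduced framework attachment, obtained from the framework attachment by deleting every edge {i, j} with i, j ∈ V_C that lies in E_B but not in E_A, also has a positive semidefinite stress matrix of nullity d + 1. -/

import Mathlib

open scoped BigOperators

noncomputable section

/-- A configuration of a framework: an assignment of points in `ℝ^d` to vertices. -/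
abbrev Config (V : Type*) (d : ℕ) := V → EuclideanSpace ℝ (Fin d)

/-- The configuration `p`, restricted to the vertex subset `A`, is in general
position. -/
def InGeneralPositionOn {V : Type*} (d : ℕ) (A : Finset V) (p : Config V d) : Prop :=
  ∀ S : Finset V, S ⊆ A → S.card = d + 1 → AffineIndependent ℝ (fun i : S => p i.1)

/-- The framework with vertex set `A`, graph `G` (whose edges lie inside `A`) and
configuration `p` is universally rigid: for every `d' ≥ d`, any configuration in
`ℝ^{d'}` with the same edge lengths has the same distances between all pairs of
vertices of `A`. -/
def UniversallyRigidOn {V : Type*} (d : ℕ) (A : Finset V) (G : SimpleGraph V)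
    (p : Config V d) : Prop :=
  ∀ d' : ℕ, d ≤ d' → ∀ q : Config V d',
    (∀ i j, G.Adj i j → dist (p i) (p j) = dist (q i) (q j)) →
    ∀ i ∈ A, ∀ j ∈ A, dist (p i) (p j) = dist (q i) (q j)

/-- The graph `G`, with vertex set `A`, is universally rigid in `ℝ^d`: every framework
of `G` whose configuration is in general position on `A` is universally rigid. -/
def UniversallyRigidGraphOn {V : Type*} (d : ℕ) (A : Finset V) (G : SimpleGraph V) :
    Prop :=
  ∀ p : Config V d, InGeneralPositionOn d A p → UniversallyRigidOn d A G p

/-- A stress matrix (indexed by the vertex subset `A`) of the framework with vertex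
set `A`, graph `G` (whose edges lie inside `A`) and configuration `p`. -/
def IsStressMatrixOn {V : Type*} [Fintype V] {d : ℕ} (A : Finset V) (G : SimpleGraph V)
    (p : Config V d) (Ω : Matrix ↥A ↥A ℝ) : Prop :=
  Ω.IsSymm ∧ (∀ i j : ↥A, i ≠ j → ¬ G.Adj i.1 j.1 → Ω i j = 0) ∧
    (∀ i : ↥A, ∑ j : ↥A, Ω i j = 0) ∧ (∀ i : ↥A, ∑ j : ↥A, Ω i j • p j.1 = 0)

/-- A stress matrix (indexed by all vertices) of the framework `G(p)`. -/
def IsStressMatrix {V : Type*} [Fintype V] {d : ℕ} (G : SimpleGraph V) (p : Config V d)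
    (Ω : Matrix V V ℝ) : Prop :=
  Ω.IsSymm ∧ (∀ i j, i ≠ j → ¬ G.Adj i j → Ω i j = 0) ∧
    (∀ i, ∑ j, Ω i j = 0) ∧ (∀ i, ∑ j, Ω i j • p j = 0)

/-- The edge-reduced attachment of the graphs `GA` and `GB` sharing the vertices of
`A ∩ B`: from the union `GA ⊔ GB` remove all edges whose endpoints are both shared
vertices and which belong to `GB` but not to `GA`. -/
def edgeReducedAttachment {V : Type*} [DecidableEq V] (A B : Finset V)
    (GA GB : SimpleGraph V) : SimpleGraph V :=
  (GA ⊔ GB).deleteEdges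
    {e : Sym2 V | e ∈ GB.edgeSet ∧ e ∉ GA.edgeSet ∧ ∀ v ∈ e, v ∈ A ∩ B}


section Aux

open scoped Matrix RealInnerProductSpace

lemma aff_unique {V : Type*} {d : ℕ} (S : Finset V) (p : Config V d)
    (hS : d + 1 ≤ S.card) (hg : InGeneralPositionOn d S p)
    (a : EuclideanSpace ℝ (Fin d)) (b : ℝ) (h : ∀ i ∈ S, ⟪a, p i⟫ + b = 0) :
    a = 0 ∧ b = 0 := by
  obtain ⟨T, hTS, hT⟩ := Finset.exists_subset_card_eq hS
  have hi := hg T hTS hT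
  have hspan := hi.affineSpan_eq_top_iff_card_eq_finrank_add_one.2 (by simp [hT])
  have hne : T.Nonempty := by rw [← Finset.card_pos]; omega
  obtain ⟨i0, hi0⟩ := hne
  have hv : vectorSpan ℝ (Set.range (fun i : T => p i.1)) = ⊤ := by
    rw [← direction_affineSpan, hspan, AffineSubspace.direction_top]
  rw [vectorSpan_range_eq_span_range_vsub_right ℝ _ (⟨i0, hi0⟩ : T)] at hv
  have hle : (⊤ : Submodule ℝ (EuclideanSpace ℝ (Fin d))) ≤ LinearMap.ker (innerₛₗ ℝ a) := by
    rw [← hv, Submodule.span_le]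
    rintro _ ⟨i, rfl⟩
    have h1 := h i.1 (hTS i.2)
    have h2 := h i0 (hTS hi0)
    simp [inner_sub_right]
    linarith
  have ha : a = 0 := by
    have := hle (Submodule.mem_top : a ∈ ⊤)
    simpa using this
  refine ⟨ha, ?_⟩
  have := h i0 (hTS hi0)
  simpa [ha] using this

/-- Affine functions, as vectors. -/
def affMap {V : Type*} {d : ℕ} (p : Config V d) :
    (EuclideanSpace ℝ (Fin d) × ℝ) →ₗ[ℝ] (V → ℝ) where
  toFun ab i := ⟪ab.1, p i⟫ + ab.2
  map_add' x y := by
    ext i; simp [inner_add_left]; ring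
  map_smul' c x := by
    ext i; simp [inner_smul_left]; ring

lemma affMap_injective {V : Type*} {d : ℕ} (p : Config V d) (S : Finset V)
    (hS : d + 1 ≤ S.card) (hg : InGeneralPositionOn d S p) :
    Function.Injective (affMap p) := by
  rw [← LinearMap.ker_eq_bot, LinearMap.ker_eq_bot']
  rintro ⟨a, b⟩ h
  obtain ⟨h1, h2⟩ := aff_unique S p hS hg a b (fun i _ => congrFun h i)
  simp [h1, h2]

lemma finrank_range_affMap {V : Type*} {d : ℕ} (p : Config V d)
    (h : Function.Injective (affMap p)) :
    Module.finrank ℝ (LinearMap.range (affMap p)) = d + 1 := by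
  rw [LinearMap.finrank_range_of_inj h]
  simp

lemma range_affMap_le {V : Type*} [Fintype V] {d : ℕ} (p : Config V d) (Ω : Matrix V V ℝ)
    (h1 : ∀ i, ∑ j, Ω i j = 0) (h2 : ∀ i, ∑ j, Ω i j • p j = 0) :
    LinearMap.range (affMap p) ≤ LinearMap.ker Ω.mulVecLin := by
  rintro _ ⟨⟨a, b⟩, rfl⟩
  rw [LinearMap.mem_ker]
  ext i
  have h3 : ⟪a, ∑ j, Ω i j • p j⟫ = 0 := by rw [h2]; simp
  simp only [inner_sum, inner_smul_right] at h3
  simp [affMap, Matrix.mulVec, dotProduct, mul_add, Finset.sum_add_distrib, h3, ← Finset.sum_mul, h1]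

lemma inf_rigid {V : Type*} [Fintype V] {d : ℕ} (A : Finset V) (G : SimpleGraph V)
    (p : Config V d) (hur : UniversallyRigidGraphOn d A G) (hg : InGeneralPositionOn d A p)
    (v : Config V d) (hv : ∀ i j, G.Adj i j → ⟪p i - p j, v i - v j⟫ = 0) :
    ∀ i ∈ A, ∀ j ∈ A, ⟪p i - p j, v i - v j⟫ = 0 := by
  have hev : ∀ᶠ t : ℝ in nhds 0, InGeneralPositionOn d A (fun i => p i + t • v i) := by
    unfold InGeneralPositionOn
    rw [Filter.eventually_all]
    intro S
    by_cases hS : S ⊆ A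
    swap
    · simp [hS]
    by_cases hc : S.card = d + 1
    swap
    · simp [hc]
    have ho := (isOpen_setOfPred_affineIndependent (𝕜 := ℝ) (E := EuclideanSpace ℝ (Fin d)) (ι := S))
    have hcont : Continuous (fun t : ℝ => fun i : S => p i.1 + t • v i.1) := by fun_prop
    have := (ho.preimage hcont).mem_nhds (x := 0) (by simpa using hg S hS hc)
    filter_upwards [this] with t ht
    intro _ _
    exact ht
  obtain ⟨ε, hε, hball⟩ := Metric.eventually_nhds_iff.1 hev
  have ht := hball (y := ε / 2) (by simp [abs_of_pos hε]; linarith)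
  have key : ∀ i j, dist (p i + (ε/2) • v i) (p j + (ε/2) • v j) = dist (p i - (ε/2) • v i) (p j - (ε/2) • v j)
      ↔ ⟪p i - p j, v i - v j⟫ = 0 := by
    intro i j
    rw [dist_eq_norm, dist_eq_norm, ← sq_eq_sq₀ (norm_nonneg _) (norm_nonneg _)]
    have e1 : p i + (ε/2) • v i - (p j + (ε/2) • v j) = (p i - p j) + (ε/2) • (v i - v j) := by
      module
    have e2 : p i - (ε/2) • v i - (p j - (ε/2) • v j) = (p i - p j) - (ε/2) • (v i - v j) := by
      module
    rw [e1, e2, norm_add_sq_real, norm_sub_sq_real (p i - p j), inner_smul_right]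
    constructor
    · intro h
      have : ε * ⟪p i - p j, v i - v j⟫ = 0 := by linarith
      exact (mul_eq_zero.1 this).resolve_left hε.ne'
    · intro h
      rw [h]; ring
  intro i hi j hj
  rw [← key]
  exact hur _ ht d le_rfl (fun i => p i - (ε/2) • v i) (fun i j hij => (key i j).2 (hv i j hij)) i hi j hj

lemma exists_cancel {V : Type*} [Fintype V] [DecidableEq V] {d : ℕ} (A : Finset V)
    (G : SimpleGraph V) (p : Config V d)
    (hG : ∀ i j, G.Adj i j → i ∈ A ∧ j ∈ A)
    (hir : ∀ v : Config V d, (∀ i j, G.Adj i j → ⟪p i - p j, v i - v j⟫ = 0) →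
      ∀ i ∈ A, ∀ j ∈ A, ⟪p i - p j, v i - v j⟫ = 0)
    (N : Matrix V V ℝ) (hN : ∀ i j, N i j = N j i) (hNA : ∀ i j, ¬ (i ∈ A ∧ j ∈ A) → N i j = 0) :
    ∃ M : Matrix V V ℝ, M.IsSymm ∧ (∀ i j, i ≠ j → ¬ G.Adj i j → M i j = N i j) ∧
      (∀ i j, ¬ (i ∈ A ∧ j ∈ A) → M i j = 0) ∧
      (∀ i, ∑ j, M i j = 0) ∧ (∀ i, ∑ j, M i j • p j = 0) := by
  classical
  let l : V × V → Config V d →ₗ[ℝ] ℝ := fun e =>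
    (innerₛₗ ℝ (p e.1 - p e.2)).comp
      (LinearMap.proj (R := ℝ) (φ := fun _ : V => EuclideanSpace ℝ (Fin d)) e.1 -
        LinearMap.proj (R := ℝ) (φ := fun _ : V => EuclideanSpace ℝ (Fin d)) e.2)
  have hl : ∀ i j v, l (i, j) v = ⟪p i - p j, v i - v j⟫ := fun i j v => by simp [l, inner_sub_left]
  let L : V × V → Config V d →ₗ[ℝ] ℝ := fun e => if G.Adj e.1 e.2 then l e else 0
  let K : Config V d →ₗ[ℝ] ℝ := ∑ e : V × V, N e.1 e.2 • l e
  have hK : K ∈ Submodule.span ℝ (Set.range L) := by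
    apply mem_span_of_iInf_ker_le_ker
    intro v hv
    simp only [Submodule.mem_iInf, LinearMap.mem_ker] at hv ⊢
    have h1 := hir v (fun i j hij => by
      have := hv (i, j)
      simp only [L, hij, if_true] at this
      rw [← hl]; exact this)
    simp only [K, LinearMap.sum_apply, LinearMap.smul_apply]
    apply Finset.sum_eq_zero
    rintro ⟨i, j⟩ _
    rw [hl]
    by_cases h : i ∈ A ∧ j ∈ A
    · rw [h1 i h.1 j h.2]; simp
    · rw [hNA i j h]; simp
  obtain ⟨c, hc⟩ := (Submodule.mem_span_range_iff_exists_fun ℝ).1 hK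
  let u : V → V → ℝ := fun i j => N i j - if G.Adj i j then c (i, j) else 0
  let g : Config V d := fun i => ∑ j, (u i j + u j i) • (p i - p j)
  have hu : ∀ v : Config V d, ∑ i, ∑ j, u i j * ⟪p i - p j, v i - v j⟫ = 0 := by
    intro v
    have := congrArg (fun f => f v) hc
    simp only [K, LinearMap.sum_apply, LinearMap.smul_apply, smul_eq_mul, L] at this
    rw [← sub_eq_zero, ← Finset.sum_sub_distrib, Fintype.sum_prod_type] at this
    rw [← neg_eq_zero, ← this, ← Finset.sum_neg_distrib]
    refine Finset.sum_congr rfl fun i _ => ?_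
    rw [← Finset.sum_neg_distrib]
    refine Finset.sum_congr rfl fun j _ => ?_
    simp only [u]
    split_ifs
    · rw [hl]; ring
    · rw [hl]; simp
  have hg : ∀ i, g i = 0 := by
    have h1 : ∑ i, ⟪g i, g i⟫ = 0 := by
      rw [← hu g]
      have h2 : ∑ i, ∑ j, u i j * ⟪p i - p j, g i - g j⟫ =
          ∑ i, ∑ j, u i j * ⟪p i - p j, g i⟫ - ∑ i, ∑ j, u i j * ⟪p i - p j, g j⟫ := by
        simp only [inner_sub_right _ (g _), mul_sub, Finset.sum_sub_distrib]
      rw [h2, Finset.sum_comm (f := fun i j => u i j * ⟪p i - p j, g j⟫),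
        ← Finset.sum_sub_distrib]
      refine Finset.sum_congr rfl fun i _ => ?_
      rw [← Finset.sum_sub_distrib]
      nth_rewrite 1 [show g i = ∑ j, (u i j + u j i) • (p i - p j) from rfl]
      rw [sum_inner]
      refine Finset.sum_congr rfl fun j _ => ?_
      rw [real_inner_smul_left, ← neg_sub (p i) (p j), inner_neg_left]
      ring
    intro i
    have := (Finset.sum_eq_zero_iff_of_nonneg (fun i _ => real_inner_self_nonneg)).1 h1 i
      (Finset.mem_univ i)
    exact inner_self_eq_zero.1 this
  let w : V → V → ℝ := fun i j => (u i j + u j i) / 2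
  have hw : ∀ i j, w i j = w j i := fun i j => by simp only [w]; ring
  have hwA : ∀ i j, ¬ (i ∈ A ∧ j ∈ A) → w i j = 0 := by
    intro i j h
    have h1 : ¬ G.Adj i j := fun h' => h (hG _ _ h')
    have h2 : ¬ G.Adj j i := fun h' => h1 h'.symm
    simp [w, u, h1, h2, hN j i, hNA i j h]
  have hwg : ∀ i, ∑ j, w i j • p j = (∑ j, w i j) • p i := by
    intro i
    have := hg i
    simp only [g, smul_sub, Finset.sum_sub_distrib, ← Finset.sum_smul] at this
    have h2 := congrArg (fun x => (1/2 : ℝ) • x) (sub_eq_zero.1 this)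
    simp only [smul_smul, Finset.smul_sum, Finset.mul_sum] at h2
    simp only [w, div_eq_inv_mul]
    simp only [one_div] at h2
    exact h2.symm
  refine ⟨fun i j => w i j - if i = j then ∑ k, w i k else 0, ?_, ?_, ?_, ?_, ?_⟩
  · ext i j
    by_cases h : i = j
    · subst h; simp [Matrix.transpose]
    · simp [Matrix.transpose, h, Ne.symm h, hw i j]
  · intro i j hij hadj
    have h2 : ¬ G.Adj j i := fun h' => hadj h'.symm
    simp [w, u, hij, hadj, h2, hN j i]
  · intro i j h
    show w i j - (if i = j then ∑ k, w i k else 0) = 0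
    rw [hwA i j h]
    split_ifs with hij
    · subst hij
      rw [Finset.sum_eq_zero]
      · simp
      · intro k _
        exact hwA i k (fun h' => h ⟨h'.1, h'.1⟩)
    · simp
  · intro i
    simp [Finset.sum_sub_distrib]
  · intro i
    simp [sub_smul, Finset.sum_sub_distrib, hwg, ite_smul]

lemma exists_dominate {V : Type*} [Fintype V] (Ω M : Matrix V V ℝ)
    (hΩ : Ω.PosSemidef) (hM : M.IsSymm)
    (hker : ∀ x, Ω *ᵥ x = 0 → M *ᵥ x = 0) :
    ∃ c : ℝ, 0 ≤ c ∧ (c • Ω - M).PosSemidef := by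
  classical
  have hΩ' := hΩ
  open scoped MatrixOrder Matrix.Norms.L2Operator in
  have hB : ∃ B : Matrix V V ℝ, Ω = star B * B := CStarAlgebra.nonneg_iff_eq_star_mul_self.mp hΩ.nonneg
  obtain ⟨B, hB⟩ := hB
  have hquad : ∀ x, x ⬝ᵥ (Ω *ᵥ x) = (B *ᵥ x) ⬝ᵥ (B *ᵥ x) := by
    intro x
    rw [hB, ← Matrix.mulVec_mulVec, Matrix.dotProduct_mulVec, Matrix.star_eq_conjTranspose,
      Matrix.vecMul_conjTranspose]
    simp
  obtain ⟨s, hs⟩ := LinearMap.exists_rightInverse_of_surjective B.mulVecLin.rangeRestrict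
    (LinearMap.range_rangeRestrict _)
  let s' := LinearMap.toContinuousLinearMap s
  let K : ℝ := ∑ i, ∑ j, |M i j|
  have hK0 : 0 ≤ K := Finset.sum_nonneg fun i _ => Finset.sum_nonneg fun j _ => abs_nonneg _
  have hKb : ∀ z : V → ℝ, z ⬝ᵥ (M *ᵥ z) ≤ K * ‖z‖ ^ 2 := by
    intro z
    simp only [dotProduct, Matrix.mulVec, K, Finset.mul_sum, Finset.sum_mul]
    refine Finset.sum_le_sum fun i _ => Finset.sum_le_sum fun j _ => ?_
    have h1 := norm_le_pi_norm z i
    have h2 := norm_le_pi_norm z j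
    calc z i * (M i j * z j) ≤ |z i * (M i j * z j)| := le_abs_self _
      _ = |M i j| * (‖z i‖ * ‖z j‖) := by rw [abs_mul, abs_mul]; simp only [Real.norm_eq_abs]; ring
      _ ≤ |M i j| * (‖z‖ * ‖z‖) := by gcongr
      _ = _ := by ring
  have hsup : ∀ y : V → ℝ, ‖y‖ ^ 2 ≤ y ⬝ᵥ y := by
    intro y
    have h0 : 0 ≤ y ⬝ᵥ y := Finset.sum_nonneg fun i _ => mul_self_nonneg _
    have : ‖y‖ ≤ Real.sqrt (y ⬝ᵥ y) := by
      rw [pi_norm_le_iff_of_nonneg (Real.sqrt_nonneg _)]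
      intro i
      apply Real.le_sqrt_of_sq_le
      rw [Real.norm_eq_abs, sq_abs, sq]
      exact Finset.single_le_sum (f := fun i => y i * y i) (fun i _ => mul_self_nonneg _)
        (Finset.mem_univ i)
    calc ‖y‖ ^ 2 ≤ (Real.sqrt (y ⬝ᵥ y)) ^ 2 := by gcongr
      _ = _ := Real.sq_sqrt h0
  refine ⟨K * ‖s'‖ ^ 2, by positivity, ?_⟩
  apply Matrix.PosSemidef.of_dotProduct_mulVec_nonneg
  · have h1 : (M : Matrix V V ℝ).IsHermitian := by
      rw [Matrix.IsHermitian, Matrix.conjTranspose_eq_transpose_of_trivial]; exact hM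
    have h2 : (Ω : Matrix V V ℝ)ᵀ = Ω := by
      have := hΩ.isHermitian
      rwa [Matrix.IsHermitian, Matrix.conjTranspose_eq_transpose_of_trivial] at this
    rw [Matrix.IsHermitian, Matrix.conjTranspose_eq_transpose_of_trivial, Matrix.transpose_sub,
      Matrix.transpose_smul, h2, hM]
  intro x
  rw [star_trivial, Matrix.sub_mulVec, Matrix.smul_mulVec, dotProduct_sub, dotProduct_smul,
    sub_nonneg, smul_eq_mul, hquad]
  let y := B.mulVecLin.rangeRestrict x
  let z := s y
  have hz : B *ᵥ z = B *ᵥ x := by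
    have := congrArg (fun f => ((f y : _) : V → ℝ)) hs
    simpa [y, z] using this
  have hMz : M *ᵥ x = M *ᵥ z := by
    rw [← sub_eq_zero, ← Matrix.mulVec_sub]
    apply hker
    rw [hB, ← Matrix.mulVec_mulVec, Matrix.mulVec_sub, hz]
    simp
  have hxz : x ⬝ᵥ (M *ᵥ x) = z ⬝ᵥ (M *ᵥ z) := by
    rw [hMz, Matrix.dotProduct_mulVec, ← Matrix.mulVec_transpose, hM, hMz, dotProduct_comm]
  rw [hxz]
  have hzn : ‖z‖ ≤ ‖s'‖ * ‖B *ᵥ x‖ := s'.le_opNorm y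
  calc z ⬝ᵥ (M *ᵥ z) ≤ K * ‖z‖ ^ 2 := hKb z
    _ ≤ K * (‖s'‖ * ‖B *ᵥ x‖) ^ 2 := by gcongr
    _ = K * ‖s'‖ ^ 2 * ‖B *ᵥ x‖ ^ 2 := by ring
    _ ≤ _ := by gcongr; exact hsup _

lemma sum_ext {V E : Type*} [Fintype V] [DecidableEq V] [AddCommMonoid E] (A : Finset V)
    (f : ↥A → E) : ∑ j : V, (if h : j ∈ A then f ⟨j, h⟩ else 0) = ∑ j : ↥A, f j := by
  rw [← Finset.sum_subset (Finset.subset_univ A), ← Finset.sum_coe_sort A]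
  · simp
  · intro x _ hx
    simp [hx]

lemma extend_stress {V : Type*} [Fintype V] [DecidableEq V] {d : ℕ} (A : Finset V)
    (G : SimpleGraph V) (p : Config V d) (hA : d + 1 ≤ A.card) (hg : InGeneralPositionOn d A p)
    (ω : Matrix ↥A ↥A ℝ) (hs : IsStressMatrixOn A G p ω) (hpsd : ω.PosSemidef)
    (hk : Module.finrank ℝ (LinearMap.ker ω.mulVecLin) = d + 1) :
    ∃ Ω : Matrix V V ℝ, IsStressMatrix G p Ω ∧ (∀ i j, ¬ (i ∈ A ∧ j ∈ A) → Ω i j = 0) ∧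
      Ω.PosSemidef ∧ ∀ x, Ω *ᵥ x = 0 → ∃ a b, ∀ i ∈ A, x i = ⟪a, p i⟫ + b := by
  obtain ⟨h1, h2, h3, h4⟩ := hs
  let Ω : Matrix V V ℝ := fun i j => if hi : i ∈ A then if hj : j ∈ A then ω ⟨i, hi⟩ ⟨j, hj⟩ else 0 else 0
  have hmul : ∀ (x : V → ℝ) i, (Ω *ᵥ x) i =
      if hi : i ∈ A then (ω *ᵥ (fun j => x j.1)) ⟨i, hi⟩ else 0 := by
    intro x i
    simp only [Matrix.mulVec, dotProduct, Ω]
    split_ifs with hi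
    · rw [← sum_ext A]
      refine Finset.sum_congr rfl fun j _ => ?_
      split_ifs <;> simp
    · simp
  have hsym : Ω.IsSymm := by
    ext i j
    show Ω j i = Ω i j
    simp only [Ω]
    by_cases hi : i ∈ A <;> by_cases hj : j ∈ A <;> simp [hi, hj, h1.apply]
  refine ⟨Ω, ⟨hsym, ?_, ?_, ?_⟩, ?_, ?_, ?_⟩
  · intro i j hij hadj
    simp only [Ω]
    split_ifs with hi hj
    · exact h2 _ _ (by simpa using hij) hadj
    · rfl
    · rfl
  · intro i
    have := hmul 1 i
    simp only [Matrix.mulVec, dotProduct, Pi.one_apply, mul_one] at this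
    rw [this]
    split_ifs with hi
    · exact h3 _
    · rfl
  · intro i
    by_cases hi : i ∈ A
    · rw [← h4 ⟨i, hi⟩, ← sum_ext A]
      refine Finset.sum_congr rfl fun j _ => ?_
      simp only [Ω, hi, dif_pos]
      split_ifs <;> simp
    · simp [Ω, hi]
  · intro i j h
    simp only [Ω]
    split_ifs with hi hj
    · exact absurd ⟨hi, hj⟩ h
    · rfl
    · rfl
  · apply Matrix.PosSemidef.of_dotProduct_mulVec_nonneg
    · rw [Matrix.IsHermitian, Matrix.conjTranspose_eq_transpose_of_trivial]; exact hsym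
    · intro x
      have := hpsd.dotProduct_mulVec_nonneg (fun j => x j.1)
      convert this using 1
      simp only [star_trivial]
      rw [dotProduct, dotProduct, ← sum_ext A]
      refine Finset.sum_congr rfl fun j _ => ?_
      rw [hmul]
      split_ifs <;> simp
  · intro x hx
    let pA : Config ↥A d := fun i => p i.1
    have hinj : Function.Injective (affMap pA) := by
      rw [← LinearMap.ker_eq_bot, LinearMap.ker_eq_bot']
      rintro ⟨a, b⟩ h
      obtain ⟨h1, h2⟩ := aff_unique A p hA hg a b (fun i hi => congrFun h ⟨i, hi⟩)
      simp [h1, h2]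
    have heq : LinearMap.range (affMap pA) = LinearMap.ker ω.mulVecLin :=
      Submodule.eq_of_le_of_finrank_eq (range_affMap_le pA ω h3 h4)
        (by rw [finrank_range_affMap pA hinj, hk])
    have hx' : (fun j : ↥A => x j.1) ∈ LinearMap.ker ω.mulVecLin := by
      rw [LinearMap.mem_ker]
      ext i
      have := congrFun hx i.1
      rw [hmul] at this
      simpa using this
    rw [← heq] at hx'
    obtain ⟨⟨a, b⟩, hab⟩ := hx'
    exact ⟨a, b, fun i hi => (congrFun hab ⟨i, hi⟩).symm⟩

lemma main_aux
    {V : Type*} [Fintype V] [DecidableEq V] {d : ℕ}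
    (A B : Finset V) (GA GB : SimpleGraph V) (p : Config V d)
    (hGA : ∀ i j, GA.Adj i j → i ∈ A ∧ j ∈ A)
    (hGB : ∀ i j, GB.Adj i j → i ∈ B ∧ j ∈ B)
    (hunion : A ∪ B = Finset.univ)
    (hcard : d + 1 ≤ (A ∩ B).card)
    (hurA : UniversallyRigidGraphOn d A GA)
    (hgenA : InGeneralPositionOn d A p) (hgenB : InGeneralPositionOn d B p)
    (hstressA : ∃ ΩA : Matrix ↥A ↥A ℝ, IsStressMatrixOn A GA p ΩA ∧ ΩA.PosSemidef ∧
      Module.finrank ℝ (LinearMap.ker ΩA.mulVecLin) = d + 1)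
    (hstressB : ∃ ΩB : Matrix ↥B ↥B ℝ, IsStressMatrixOn B GB p ΩB ∧ ΩB.PosSemidef ∧
      Module.finrank ℝ (LinearMap.ker ΩB.mulVecLin) = d + 1) :
    ∃ Ω : Matrix V V ℝ, IsStressMatrix (edgeReducedAttachment A B GA GB) p Ω ∧
      Ω.PosSemidef ∧
      Module.finrank ℝ (LinearMap.ker Ω.mulVecLin) = d + 1 := by
  classical
  obtain ⟨ωA, hsA, hpA, hkA⟩ := hstressA
  obtain ⟨ωB, hsB, hpB, hkB⟩ := hstressB
  have hgenC : InGeneralPositionOn d (A ∩ B) p := fun S hS =>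
    hgenA S (hS.trans Finset.inter_subset_left)
  obtain ⟨ΩA, ⟨a1, a2, a3, a4⟩, aout, apsd, aker⟩ := extend_stress A GA p
    (hcard.trans (Finset.card_le_card Finset.inter_subset_left)) hgenA ωA hsA hpA hkA
  obtain ⟨ΩB, ⟨b1, b2, b3, b4⟩, bout, bpsd, bker⟩ := extend_stress B GB p
    (hcard.trans (Finset.card_le_card Finset.inter_subset_right)) hgenB ωB hsB hpB hkB
  obtain ⟨M, m1, m2, mout, m3, m4⟩ := exists_cancel A GA p hGA
    (fun v hv => inf_rigid A GA p hurA hgenA v hv)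
    (fun i j => if i ∈ A ∩ B ∧ j ∈ A ∩ B then ΩB i j else 0)
    (fun i j => by simp only [b1.apply i j, and_comm])
    (fun i j h => if_neg fun h' =>
      h ⟨Finset.mem_of_mem_inter_left h'.1, Finset.mem_of_mem_inter_left h'.2⟩)
  obtain ⟨c, hc0, hc⟩ := exists_dominate ΩA M apsd m1 (by
    intro x hx
    obtain ⟨a, b, hab⟩ := aker x hx
    have h0 : M *ᵥ (affMap p (a, b)) = 0 :=
      range_affMap_le p M m3 m4 (LinearMap.mem_range_self _ (a, b))
    rw [← h0]
    ext i
    simp only [Matrix.mulVec, dotProduct]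
    refine Finset.sum_congr rfl fun j _ => ?_
    by_cases hj : j ∈ A
    · rw [hab j hj]; rfl
    · rw [mout i j (fun h => hj h.2)]; simp)
  let Ω : Matrix V V ℝ := ΩB + (ΩA + (c • ΩA - M))
  have happ : ∀ i j, Ω i j = ΩB i j + (ΩA i j + (c * ΩA i j - M i j)) := fun i j => rfl
  have hpsd1 := apsd.add hc
  have hpsd : Ω.PosSemidef := bpsd.add hpsd1
  have r3 : ∀ i, ∑ j, Ω i j = 0 := by
    intro i
    simp only [happ, Finset.sum_add_distrib, Finset.sum_sub_distrib, ← Finset.mul_sum, a3, b3, m3]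
    simp
  have r4 : ∀ i, ∑ j, Ω i j • p j = 0 := by
    intro i
    simp only [happ, add_smul, sub_smul, mul_smul, Finset.sum_add_distrib, Finset.sum_sub_distrib,
      ← Finset.smul_sum, a4, b4, m4]
    simp
  refine ⟨Ω, ⟨?_, ?_, r3, r4⟩, hpsd, ?_⟩
  · ext i j
    rw [Matrix.transpose_apply, happ, happ, a1.apply, b1.apply, m1.apply]
  · intro i j hij hadj
    have hadj' : ¬ ((GA.Adj i j ∨ GB.Adj i j) ∧
        ¬ (GB.Adj i j ∧ ¬ GA.Adj i j ∧ i ∈ A ∩ B ∧ j ∈ A ∩ B)) := by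
      intro h
      apply hadj
      rw [edgeReducedAttachment, SimpleGraph.deleteEdges_adj]
      refine ⟨h.1, fun h' => h.2 ⟨h'.1, h'.2.1, h'.2.2 i (by simp), h'.2.2 j (by simp)⟩⟩
    have hA : ¬ GA.Adj i j := fun h => hadj' ⟨Or.inl h, fun h' => h'.2.1 h⟩
    rw [happ, a2 i j hij hA, m2 i j hij hA]
    by_cases hB : GB.Adj i j
    · have hC : i ∈ A ∩ B ∧ j ∈ A ∩ B := by
        by_contra h
        exact hadj' ⟨Or.inr hB, fun h' => h h'.2.2⟩
      simp only [hC, and_self, if_true]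
      ring
    · rw [b2 i j hij hB]
      simp
  · rw [← finrank_range_affMap p (affMap_injective p (A ∩ B) hcard hgenC)]
    suffices hrk : LinearMap.ker Ω.mulVecLin = LinearMap.range (affMap p) by rw [hrk]
    refine le_antisymm ?_ (range_affMap_le p Ω r3 r4)
    intro x hx
    rw [LinearMap.mem_ker, Matrix.mulVecLin_apply] at hx
    have hq : x ⬝ᵥ (Ω *ᵥ x) = 0 := by rw [hx]; simp
    have q1 := bpsd.dotProduct_mulVec_nonneg x
    have q2 := apsd.dotProduct_mulVec_nonneg x
    have q3 := hc.dotProduct_mulVec_nonneg x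
    simp only [Ω, Matrix.add_mulVec, dotProduct_add] at hq
    rw [star_trivial] at q1 q2 q3
    have kA := (apsd.dotProduct_mulVec_zero_iff x).1 (by rw [star_trivial]; linarith)
    have kB := (bpsd.dotProduct_mulVec_zero_iff x).1 (by rw [star_trivial]; linarith)
    obtain ⟨a, b, hab⟩ := aker x kA
    obtain ⟨a', b', hab'⟩ := bker x kB
    obtain ⟨e1, e2⟩ := aff_unique (A ∩ B) p hcard hgenC (a - a') (b - b') (by
      intro i hi
      have h1 := hab i (Finset.mem_of_mem_inter_left hi)
      have h2 := hab' i (Finset.mem_of_mem_inter_right hi)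
      rw [inner_sub_left]
      linarith)
    rw [sub_eq_zero] at e1 e2
    subst e1 e2
    refine ⟨(a, b), ?_⟩
    ext i
    have hi : i ∈ A ∪ B := hunion ▸ Finset.mem_univ i
    rcases Finset.mem_union.1 hi with h | h
    · exact (hab i h).symm
    · exact (hab' i h).symm

end Aux

/-- If `G_A` and `G_B` are universally rigid graphs in `ℝ^d` sharing at least `d + 1`
vertices, and `p` is in general position on each vertex set and the two frameworks
have positive semidefinite stress matrices of nullity `d + 1`, then the edge-reduced
framework attachment also has a positive semidefinite stress matrix of
nullity `d + 1`. -/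
theorem edgeReducedAttachment_exists_psd_stressMatrix_of_universallyRigidGraphs
    {V : Type*} [Fintype V] [DecidableEq V] {d : ℕ}
    (A B : Finset V) (GA GB : SimpleGraph V) (p : Config V d)
    (hGA : ∀ i j, GA.Adj i j → i ∈ A ∧ j ∈ A)
    (hGB : ∀ i j, GB.Adj i j → i ∈ B ∧ j ∈ B)
    (hunion : A ∪ B = Finset.univ)
    (hcard : d + 1 ≤ (A ∩ B).card)
    (hpropA : A ∩ B ⊂ A) (hpropB : A ∩ B ⊂ B)
    (hurA : UniversallyRigidGraphOn d A GA) (hurB : UniversallyRigidGraphOn d B GB)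
    (hgenA : InGeneralPositionOn d A p) (hgenB : InGeneralPositionOn d B p)
    (hstressA : ∃ ΩA : Matrix ↥A ↥A ℝ, IsStressMatrixOn A GA p ΩA ∧ ΩA.PosSemidef ∧
      Module.finrank ℝ (LinearMap.ker ΩA.mulVecLin) = d + 1)
    (hstressB : ∃ ΩB : Matrix ↥B ↥B ℝ, IsStressMatrixOn B GB p ΩB ∧ ΩB.PosSemidef ∧
      Module.finrank ℝ (LinearMap.ker ΩB.mulVecLin) = d + 1) :
    ∃ Ω : Matrix V V ℝ, IsStressMatrix (edgeReducedAttachment A B GA GB) p Ω ∧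
      Ω.PosSemidef ∧
      Module.finrank ℝ (LinearMap.ker Ω.mulVecLin) = d + 1 := by
  exact main_aux A B GA GB p hGA hGB hunion hcard hurA hgenA hgenB hstressA hstressB
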